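/- For a one-dimensional cumulative distribution function (cdf) $F$ write $F^{[-1]}(u):=\inf\{x\in\mathbb R: F(x)\ge u\}\in[-\infty,\infty]$; this is a real number for $u\in(0,1)$. Let $T=I_1\times\dots\times I_d\subset\mathbb R^d$ be a product of (possibly unbounded) intervals, and let $U=(U_t)_{t\in T}$ be a copula process, i.e. a family of real random variables on a probability space, each uniformly distributed on $[0,1]$. Assume that, almost surely, the path $t\mapsto U_t$ is continuous on $T$ and takes values in the open interval $(0,1)$, i.e. $0<U_t<1$ for all $t\in T$ simultaneously. Let $(F_t)_{t\in T}$ be a family of one-dimensional cdfs that is continuous in distribution (for each $t\in T$, $\lim_{s\to t}F_s(x_0)=F_t(x_0)$ at every continuity point $x_0$ of $F_t$) and such that each $F_t$ is strictly increasing between $F_t^{[-1]}(0+):=\lim_{u\downarrow0}F_t^{[-1]}(u)$ and $F_t^{[-1]}(1)$. Then $Y=(Y_t)_{t\in T}$ defined by $Y_t:=F_t^{[-1]}(U_t)$ (and, on the null event where this value is infinite, $Y_t:=0$) is a stochastic process whose paths are almost surely in the space $C(T)$ of continuous real functions on $T$, has marginal cdfs $F_t$, and has underlying copula process $U$, i.e.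 for every finite $J\subseteq T$ and all $(x_j)_{j\in J}\in\mathbb R^J$, $$\mathbb P\big(U_j\le F_j(x_j)\ \text{for all } j\in J\big)=\mathbb P\big(Y_j\le x_j\ \text{for all } j\in J\big).$$ Moreover, if $T$ is compact, then $Y$ is (after modification on a null event, so that all of its paths lie in $C(T)$) measurable with respect to the Borel $\sigma$-algebra of the Banach space $C(T)$ with the supremum norm. -/

import Mathlib

open MeasureTheory ProbabilityTheory Filter Topology

/-- A one-dimensional cumulative distribution function: monotone, right-continuous,
with limits `0` at `-∞` and `1` at `+∞`. -/
def IsCDFFun (F : ℝ → ℝ) : Prop :=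
  Monotone F ∧ (∀ x, ContinuousWithinAt F (Set.Ici x) x) ∧
    Tendsto F atBot (𝓝 0) ∧ Tendsto F atTop (𝓝 1)

/-- The quantile function `F^{[-1]}(u) = inf {x ∈ ℝ : F(x) ≥ u}`, the infimum being taken in
`[-∞, ∞]`, so that `F^{[-1]}(0) = -∞` and `F^{[-1]}(1)` may be `+∞`. -/
noncomputable def quantile (F : ℝ → ℝ) (u : ℝ) : EReal :=
  sInf ((fun x : ℝ => (x : EReal)) '' {x : ℝ | u ≤ F x})

/-- `F` is strictly increasing between `F^{[-1]}(0+) = lim_{u ↓ 0} F^{[-1]}(u)` and `F^{[-1]}(1)`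
(both possibly infinite). -/
def StrictMonoBetweenQuantiles (F : ℝ → ℝ) : Prop :=
  StrictMonoOn F
    {x : ℝ | Function.rightLim (quantile F) 0 < (x : EReal) ∧ (x : EReal) < quantile F 1}

/-- A family of cdfs is continuous in distribution. -/
def ContinuousInDistribution {T : Type*} [TopologicalSpace T] (F : T → ℝ → ℝ) : Prop :=
  ∀ (t : T) (x₀ : ℝ), ContinuousAt (F t) x₀ → Tendsto (fun s => F s x₀) (𝓝 t) (𝓝 (F t x₀))

/-- A copula process: a random element of `ℝ^T` whose coordinates are uniform on `[0,1]`. -/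
def IsCopulaProcess {T Ω : Type*} [MeasurableSpace Ω] (U : T → Ω → ℝ) (P : Measure Ω) : Prop :=
  Measurable (fun ω t => U t ω) ∧ ∀ t, pdf.IsUniform (U t) (Set.Icc 0 1) P volume

/-- The cumulative distribution function of a measure on `ℝ^J`. -/
noncomputable def multiCDF {J : Type*} (ν : Measure (J → ℝ)) (x : J → ℝ) : ℝ :=
  ν.real (Set.Iic x)

/-- The Sklar relation between laws `C` and `μ` on `ℝ^T`: for every finite `J ⊆ T`,
`F_{C_J}((F_{μ_j}(x_j))_{j ∈ J}) = F_{μ_J}((x_j)_{j ∈ J})`. -/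
def SklarRelation {T : Type*} (C μ : Measure (T → ℝ)) : Prop :=
  ∀ (J : Finset T) (x : J → ℝ),
    multiCDF (C.map J.restrict) (fun j => cdf (μ.map (fun y => y (j : T))) (x j)) =
      multiCDF (μ.map J.restrict) x

/-- The copula process `U` underlies the process `Y`. -/
def Underlies {T Ω : Type*} [MeasurableSpace Ω] (U Y : T → Ω → ℝ) (P : Measure Ω) : Prop :=
  SklarRelation (P.map (fun ω t => U t ω)) (P.map (fun ω t => Y t ω))

theorem quantile_mono (F : ℝ → ℝ) : Monotone (quantile F) := fun _ _ h =>
  sInf_le_sInf (Set.image_mono fun _ hx => h.trans hx)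

theorem quantile_le_coe_iff {F : ℝ → ℝ} (hF : IsCDFFun F) {u y : ℝ} :
    quantile F u ≤ (y : EReal) ↔ u ≤ F y := by
  refine ⟨fun h => ?_, fun h => sInf_le ⟨y, h, rfl⟩⟩
  have key : ∀ z, y < z → u ≤ F z := by
    intro z hz
    obtain ⟨_, ⟨x, hx, rfl⟩, hxz⟩ := sInf_lt_iff.1 (h.trans_lt (EReal.coe_lt_coe_iff.2 hz))
    exact hx.trans (hF.1 (EReal.coe_lt_coe_iff.1 hxz).le)
  have ht : Tendsto F (𝓝[>] y) (𝓝 (F y)) :=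
    (hF.2.1 y).mono_left (nhdsWithin_mono _ Set.Ioi_subset_Ici_self)
  exact ge_of_tendsto ht (eventually_nhdsWithin_of_forall key)

theorem coe_lt_quantile_iff {F : ℝ → ℝ} (hF : IsCDFFun F) {u y : ℝ} :
    (y : EReal) < quantile F u ↔ F y < u := by
  rw [← not_le, quantile_le_coe_iff hF, not_le]

theorem IsCDFFun.mem_Icc {F : ℝ → ℝ} (hF : IsCDFFun F) (x : ℝ) : F x ∈ Set.Icc (0 : ℝ) 1 :=
  ⟨hF.1.le_of_tendsto hF.2.2.1 x, hF.1.ge_of_tendsto hF.2.2.2 x⟩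

theorem coe_toReal_quantile {F : ℝ → ℝ} (hF : IsCDFFun F) {u : ℝ} (hu : u ∈ Set.Ioo (0 : ℝ) 1) :
    ((quantile F u).toReal : EReal) = quantile F u := by
  refine EReal.coe_toReal (fun h => ?_) (fun h => ?_)
  · obtain ⟨x, hx⟩ := (hF.2.2.2.eventually (lt_mem_nhds hu.2)).exists
    have := (quantile_le_coe_iff hF).2 hx.le
    rw [h, top_le_iff] at this
    exact EReal.coe_ne_top _ this
  · obtain ⟨x, hx⟩ := (hF.2.2.1.eventually (gt_mem_nhds hu.1)).exists
    have := (coe_lt_quantile_iff hF).2 hx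
    rw [h] at this
    exact not_lt_bot this

theorem toReal_quantile_le_iff {F : ℝ → ℝ} (hF : IsCDFFun F) {u : ℝ}
    (hu : u ∈ Set.Ioo (0 : ℝ) 1) {y : ℝ} : (quantile F u).toReal ≤ y ↔ u ≤ F y := by
  rw [← quantile_le_coe_iff hF, ← coe_toReal_quantile hF hu, EReal.coe_le_coe_iff,
    EReal.toReal_coe]

/-- Strict monotonicity between the extreme quantiles means that the cdf exceeds the level `u`
immediately to the right of the `u`-quantile. -/
theorem lt_apply_of_toReal_quantile_lt {F : ℝ → ℝ} (hF : IsCDFFun F)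
    (hmono : StrictMonoBetweenQuantiles F) {u : ℝ} (hu : u ∈ Set.Ioo (0 : ℝ) 1) {b : ℝ}
    (hb : (quantile F u).toReal < b) : u < F b := by
  by_cases h1 : (b : EReal) < quantile F 1
  · obtain ⟨c, hc, hcb⟩ := exists_between hb
    have hlow : Function.rightLim (quantile F) 0 < (c : EReal) := by
      refine ((quantile_mono F).rightLim_le hu.1).trans_lt ?_
      rw [← coe_toReal_quantile hF hu]
      exact EReal.coe_lt_coe_iff.2 hc
    have hcb' : (c : EReal) < b := EReal.coe_lt_coe_iff.2 hcb
    exact ((toReal_quantile_le_iff hF hu).1 hc.le).trans_lt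
      (hmono ⟨hlow, hcb'.trans h1⟩ ⟨hlow.trans hcb', h1⟩ hcb)
  · exact hu.2.trans_le ((quantile_le_coe_iff hF).1 (not_lt.1 h1))

theorem Monotone.exists_continuousAt_mem_Ioo {F : ℝ → ℝ} (hF : Monotone F) {a b : ℝ}
    (hab : a < b) : ∃ c ∈ Set.Ioo a b, ContinuousAt F c := by
  obtain ⟨c, hc, hc'⟩ := (hF.countable_not_continuousAt.dense_compl ℝ).exists_mem_open isOpen_Ioo
    (Set.nonempty_Ioo.2 hab)
  exact ⟨c, hc', not_not.1 hc⟩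

/-- Joint continuity of the quantile `(t, u) ↦ F_t^{[-1]}(u)`. -/
theorem continuousAt_toReal_quantile {T : Type*} [TopologicalSpace T] {F : T → ℝ → ℝ}
    (hF : ∀ t, IsCDFFun (F t)) (hFdist : ContinuousInDistribution F)
    (hFmono : ∀ t, StrictMonoBetweenQuantiles (F t)) {v : T → ℝ}
    (hv : ∀ t, v t ∈ Set.Ioo (0 : ℝ) 1) {t : T} (hvt : ContinuousAt v t) :
    ContinuousAt (fun s => (quantile (F s) (v s)).toReal) t := by
  refine tendsto_order.2 ⟨fun a ha => ?_, fun b hb => ?_⟩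
  · obtain ⟨c, ⟨hac, hc⟩, hcont⟩ := (hF t).1.exists_continuousAt_mem_Ioo ha
    have hlt : F t c < v t := not_le.1 fun h =>
      hc.not_ge ((toReal_quantile_le_iff (hF t) (hv t)).2 h)
    filter_upwards [(hFdist t c hcont).eventually_lt hvt hlt] with s hs
    refine not_le.1 fun h => ?_
    exact (((toReal_quantile_le_iff (hF s) (hv s)).1 h).trans ((hF s).1 hac.le)).not_gt hs
  · obtain ⟨c, ⟨hc, hcb⟩, hcont⟩ := (hF t).1.exists_continuousAt_mem_Ioo hb
    have hlt : v t < F t c := lt_apply_of_toReal_quantile_lt (hF t) (hFmono t) (hv t) hc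
    filter_upwards [Tendsto.eventually_lt hvt (hFdist t c hcont) hlt] with s hs
    exact ((toReal_quantile_le_iff (hF s) (hv s)).2 hs.le).trans_lt hcb

theorem MeasureTheory.pdf.IsUniform.measureReal_le {Ω : Type*} [MeasurableSpace Ω] {P : Measure Ω}
    {X : Ω → ℝ} (hX : Measurable X) (hu : pdf.IsUniform X (Set.Icc 0 1) P volume) {c : ℝ}
    (hc : c ∈ Set.Icc (0 : ℝ) 1) : P.real {ω | X ω ≤ c} = c := by
  have h : P {ω | X ω ≤ c} = ENNReal.ofReal c := by
    have : P {ω | X ω ≤ c} = P.map X (Set.Iic c) :=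
      (Measure.map_apply hX measurableSet_Iic).symm
    rw [this, hu, ProbabilityTheory.cond_apply measurableSet_Icc]
    have hI : Set.Icc (0 : ℝ) 1 ∩ Set.Iic c = Set.Icc 0 c := by
      ext x
      simp only [Set.mem_inter_iff, Set.mem_Icc, Set.mem_Iic]
      exact ⟨fun h => ⟨h.1.1, h.2⟩, fun h => ⟨⟨h.1, h.2.trans hc.2⟩, h.2⟩⟩
    simp [hI]
  rw [measureReal_def, h, ENNReal.toReal_ofReal hc.1]

/-- A map into `C(X, ℝ)`, with `X` compact and metrizable, is Borel measurable as soon as all its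
evaluations are. -/
theorem ContinuousMap.measurable_borel_of_eval {X Ω : Type*} [TopologicalSpace X] [CompactSpace X]
    [T2Space X] [SecondCountableTopology X] [MeasurableSpace Ω] {Z : Ω → C(X, ℝ)}
    (hZ : ∀ x, Measurable fun ω => Z ω x) : @Measurable _ _ _ (borel C(X, ℝ)) Z := by
  let : MeasurableSpace C(X, ℝ) := borel _
  have : BorelSpace C(X, ℝ) := ⟨rfl⟩
  obtain ⟨D, hDc, hDd⟩ := TopologicalSpace.exists_countable_dense X
  have : Countable D := hDc
  let e : C(X, ℝ) → D → ℝ := fun f x => f x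
  have he : Continuous e := continuous_pi fun x => continuous_eval_const (x : X)
  have hinj : Function.Injective e := by
    intro f g hfg
    refine ContinuousMap.coe_injective (f.continuous.ext_on hDd g.continuous fun x hx => ?_)
    exact congrFun hfg ⟨x, hx⟩
  exact (he.measurableEmbedding hinj).measurable_comp_iff.1 (measurable_pi_iff.2 fun x => hZ x)

/-- Construction of continuous processes from a copula process `U` with almost surely continuous
paths in `(0,1)` and marginal cdfs `F t`. Since `Y` is real valued, `toReal` is applied to the
quantile; the second conclusion says that this changes nothing, almost surely for all `t` at
once. -/
theorem sklar_construction_continuous_processes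
    {d : ℕ} (S : Fin d → Set ℝ) (hS : ∀ i, (S i).OrdConnected)
    {Ω : Type*} [MeasurableSpace Ω] (P : Measure Ω) [IsProbabilityMeasure P]
    (U : ↥(Set.univ.pi S) → Ω → ℝ)
    (hU : IsCopulaProcess U P)
    (hUcont : ∀ᵐ ω ∂P, Continuous fun t => U t ω)
    (hU01 : ∀ᵐ ω ∂P, ∀ t, U t ω ∈ Set.Ioo (0 : ℝ) 1)
    (F : ↥(Set.univ.pi S) → ℝ → ℝ)
    (hF : ∀ t, IsCDFFun (F t))
    (hFdist : ContinuousInDistribution F)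
    (hFmono : ∀ t, StrictMonoBetweenQuantiles (F t))
    (Y : ↥(Set.univ.pi S) → Ω → ℝ)
    (hY : ∀ t ω, Y t ω = (quantile (F t) (U t ω)).toReal) :
    Measurable (fun ω t => Y t ω) ∧
      (∀ᵐ ω ∂P, ∀ t, (Y t ω : EReal) = quantile (F t) (U t ω)) ∧
      (∀ᵐ ω ∂P, Continuous fun t => Y t ω) ∧
      (∀ t x, cdf (P.map (Y t)) x = F t x) ∧
      Underlies U Y P ∧
      (IsCompact (Set.univ.pi S) →
        ∃ Z : Ω → C(↥(Set.univ.pi S), ℝ),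
          @Measurable _ _ _ (borel C(↥(Set.univ.pi S), ℝ)) Z ∧
            ∀ᵐ ω ∂P, ∀ t, Z ω t = Y t ω) := by
  obtain ⟨hUmeas, hUunif⟩ := hU
  have hUm : ∀ t, Measurable (U t) := fun t => measurable_pi_iff.1 hUmeas t
  have hYm : ∀ t, Measurable (Y t) := by
    intro t
    rw [show Y t = fun ω => (quantile (F t) (U t ω)).toReal from funext (hY t)]
    exact measurable_ereal_toReal.comp ((quantile_mono (F t)).measurable.comp (hUm t))
  have hYmeas : Measurable (fun ω t => Y t ω) := measurable_pi_iff.2 hYm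
  have hle : ∀ᵐ ω ∂P, ∀ t x, Y t ω ≤ x ↔ U t ω ≤ F t x := by
    filter_upwards [hU01] with ω h t x
    rw [hY]
    exact toReal_quantile_le_iff (hF t) (h t)
  have hYcont : ∀ᵐ ω ∂P, Continuous fun t => Y t ω := by
    filter_upwards [hU01, hUcont] with ω h hc
    simp_rw [hY]
    exact continuous_iff_continuousAt.2 fun t =>
      continuousAt_toReal_quantile hF hFdist hFmono h hc.continuousAt
  have hcdf : ∀ t x, cdf (P.map (Y t)) x = F t x := by
    intro t x
    have := Measure.isProbabilityMeasure_map (μ := P) (hYm t).aemeasurable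
    rw [cdf_eq_real, map_measureReal_apply (hYm t) measurableSet_Iic,
      ← (hUunif t).measureReal_le (hUm t) ((hF t).mem_Icc x)]
    refine measureReal_congr ?_
    filter_upwards [hle] with ω h
    exact propext (h t x)
  refine ⟨hYmeas, ?_, hYcont, hcdf, ?_, ?_⟩
  · filter_upwards [hU01] with ω h t
    rw [hY, coe_toReal_quantile (hF t) (h t)]
  · intro J x
    have hmarg : ∀ t, (P.map fun ω t => Y t ω).map (fun y => y t) = P.map (Y t) := fun t =>
      Measure.map_map (measurable_pi_apply t) hYmeas
    simp only [hmarg, hcdf, multiCDF]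
    have hJ : Measurable (J.restrict (π := fun _ => ℝ)) := Finset.measurable_restrict J
    rw [Measure.map_map hJ hUmeas, Measure.map_map hJ hYmeas,
      map_measureReal_apply (hJ.comp hUmeas) measurableSet_Iic,
      map_measureReal_apply (hJ.comp hYmeas) measurableSet_Iic]
    refine measureReal_congr ?_
    filter_upwards [hle] with ω h
    exact propext (forall_congr' fun j => (h j (x j)).symm)
  · intro hT
    have : CompactSpace ↥(Set.univ.pi S) := isCompact_iff_compactSpace.1 hT
    obtain ⟨E, hEsub, hEm, hEnull⟩ := exists_measurable_superset_of_null (ae_iff.1 hYcont)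
    have hc : ∀ ω, ω ∉ E → Continuous fun t => Y t ω := fun ω hω =>
      not_not.1 fun h => hω (hEsub h)
    classical
    refine ⟨fun ω => if h : ω ∈ E then 0 else ⟨fun t => Y t ω, hc ω h⟩,
      ContinuousMap.measurable_borel_of_eval fun t => ?_, ?_⟩
    · have heq : (fun ω => (if h : ω ∈ E then 0 else ⟨fun t => Y t ω, hc ω h⟩ :
          C(↥(Set.univ.pi S), ℝ)) t) = fun ω => if ω ∈ E then (0 : ℝ) else Y t ω := by
        funext ω
        split_ifs <;> rfl
      rw [heq]
      exact Measurable.ite hEm measurable_const (hYm t)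
    · filter_upwards [measure_eq_zero_iff_ae_notMem.1 hEnull] with ω hω t
      simp [hω]
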